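/- The modal μ-calculus L_μ is closed for product update: for every event model A = (Σ, E, PRE) with preconditions in L_μ, every event α ∈ Σ, and every formula ψ ∈ L_μ, there exists a formula χ ∈ L_μ such that χ ≡ ⟨α⟩ψ is valid, i.e. for every relational model M and point ω: M, ω ⊨ χ if and only if M, ω ⊨ Pre_α and M ⊗ A, (ω, α) ⊨ ψ. -/

import Mathlib

/-- A relational model over a set of worlds `W`. -/
structure Model (W : Type) where
  rel : W → W → Prop
  val : ℕ → Set W

/-- Change the valuation of the proposition letter `p` to `X`. -/
def Model.update {W : Type} (M : Model W) (p : ℕ) (X : Set W) : Model W :=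
  ⟨M.rel, fun q => if q = p then X else M.val q⟩

/-- Restriction (relativisation) of a model to a subset of its domain. -/
def Model.restrict {W : Type} (M : Model W) (A : Set W) : Model A :=
  ⟨fun a b => M.rel a.1 b.1, fun p => {a | a.1 ∈ M.val p}⟩

/-- The language `L∃U`: propositionally quantified modal logic with the global modality. -/
inductive Form : Type where
  | atom : ℕ → Form
  | neg : Form → Form
  | and : Form → Form → Form
  | box : Form → Form
  | ex : ℕ → Form → Form
  | uni : Form → Form

/-- Satisfaction for `L∃U`. -/
def Sat {W : Type} : Model W → W → Form → Prop
  | M, w, .atom p => w ∈ M.val p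
  | M, w, .neg φ => ¬ Sat M w φ
  | M, w, .and φ ψ => Sat M w φ ∧ Sat M w ψ
  | M, w, .box φ => ∀ v, M.rel w v → Sat M v φ
  | M, w, .ex p φ => ∃ X : Set W, Sat (M.update p X) w φ
  | M, w, .uni φ => ∀ v, Sat M v φ

/-- Material implication, `φ ⊃ ψ`. -/
def Form.imp (φ ψ : Form) : Form := .neg (.and φ (.neg ψ))

/-- The proposition letter `p` occurs in a formula. -/
def Form.Occurs (p : ℕ) : Form → Prop
  | .atom q => q = p
  | .neg φ => φ.Occurs p
  | .and φ ψ => φ.Occurs p ∨ ψ.Occurs p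
  | .box φ => φ.Occurs p
  | .ex q φ => q = p ∨ φ.Occurs p
  | .uni φ => φ.Occurs p

/-- The formula contains no global modality `U` (i.e. is in `L∃`). -/
def Form.UFree : Form → Prop
  | .atom _ => True
  | .neg φ => φ.UFree
  | .and φ ψ => φ.UFree ∧ ψ.UFree
  | .box φ => φ.UFree
  | .ex _ φ => φ.UFree
  | .uni _ => False

/-- Semantics of the dynamic relativisation (public announcement) modality `⟨!A⟩φ`. -/
def SatRel {W : Type} (M : Model W) (w : W) (A φ : Form) : Prop :=
  ∃ h : w ∈ {v | Sat M v A}, Sat (M.restrict {v | Sat M v A}) ⟨w, h⟩ φ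

/-- An event model with `n` events `α_0, …, α_{n-1}`, preconditions in `L∃U`. -/
structure EventModel (n : ℕ) where
  E : Fin n → Fin n → Prop
  pre : Fin n → Form

/-- The domain of the product update `M ⊗ A`. -/
def prodDomain {W : Type} (M : Model W) {n : ℕ} (A : EventModel n) : Set (W × Fin n) :=
  {x | Sat M x.1 (A.pre x.2)}

/-- The product update `M ⊗ A`. -/
def prodModel {W : Type} (M : Model W) {n : ℕ} (A : EventModel n) :
    Model (prodDomain M A) :=
  ⟨fun x y => M.rel x.1.1 y.1.1 ∧ A.E x.1.2 y.1.2, fun p => {x | x.1.1 ∈ M.val p}⟩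

/-- Semantics of the action modality `⟨α⟩φ` for `φ ∈ L∃U`. -/
def SatAct {W : Type} {n : ℕ} (M : Model W) (A : EventModel n) (α : Fin n) (w : W)
    (φ : Form) : Prop :=
  ∃ h : (w, α) ∈ prodDomain M A, Sat (prodModel M A) ⟨(w, α), h⟩ φ

/-- The set of sentences `S∃Uj`: `L∃U` plus action nominals `j_i`. -/
inductive FormJ (n : ℕ) : Type where
  | atom : ℕ → FormJ n
  | nom : Fin n → FormJ n
  | neg : FormJ n → FormJ n
  | and : FormJ n → FormJ n → FormJ n
  | box : FormJ n → FormJ n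
  | ex : ℕ → FormJ n → FormJ n
  | uni : FormJ n → FormJ n

/-- Satisfaction for `S∃Uj`, relative to a labelling of worlds by events
(in a product model `M ⊗ A` the label of `(ω, α)` is `α`). -/
def SatJ {n : ℕ} {V : Type} (lab : V → Fin n) : Model V → V → FormJ n → Prop
  | M, w, .atom p => w ∈ M.val p
  | _, w, .nom i => lab w = i
  | M, w, .neg φ => ¬ SatJ lab M w φ
  | M, w, .and φ ψ => SatJ lab M w φ ∧ SatJ lab M w ψ
  | M, w, .box φ => ∀ v, M.rel w v → SatJ lab M v φ
  | M, w, .ex p φ => ∃ X : Set V, SatJ lab (M.update p X) w φ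
  | M, w, .uni φ => ∀ v, SatJ lab M v φ

/-- Semantics of the action modality `⟨α⟩ψ` applied to a sentence `ψ ∈ S∃Uj`:
`M, w ⊨ ⟨α⟩ψ` iff `M, w ⊨ Pre_α` and `M ⊗ A, (w, α) ⊨ ψ`. -/
def SatActJ {W : Type} {n : ℕ} (M : Model W) (A : EventModel n) (α : Fin n) (w : W)
    (ψ : FormJ n) : Prop :=
  ∃ h : (w, α) ∈ prodDomain M A,
    SatJ (fun x : prodDomain M A => x.1.2) (prodModel M A) ⟨(w, α), h⟩ ψ

/-- The proposition letter `p` occurs in a sentence of `S∃Uj`. -/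
def FormJ.Occurs {n : ℕ} (p : ℕ) : FormJ n → Prop
  | .atom q => q = p
  | .nom _ => False
  | .neg φ => φ.Occurs p
  | .and φ ψ => φ.Occurs p ∨ ψ.Occurs p
  | .box φ => φ.Occurs p
  | .ex q φ => q = p ∨ φ.Occurs p
  | .uni φ => φ.Occurs p

/-- Substitution `φ(σ)` of the sentence `σ` for the proposition letter `p` in `φ`. -/
def FormJ.subst {n : ℕ} (p : ℕ) (σ : FormJ n) : FormJ n → FormJ n
  | .atom q => if q = p then σ else .atom q
  | .nom i => .nom i
  | .neg φ => .neg (FormJ.subst p σ φ)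
  | .and φ ψ => .and (FormJ.subst p σ φ) (FormJ.subst p σ ψ)
  | .box φ => .box (FormJ.subst p σ φ)
  | .ex q φ => if q = p then .ex q φ else .ex q (FormJ.subst p σ φ)
  | .uni φ => .uni (FormJ.subst p σ φ)

/-- Disjunction, defined from `¬` and `∧`. -/
def FormJ.or {n : ℕ} (φ ψ : FormJ n) : FormJ n := .neg (.and (.neg φ) (.neg ψ))

/-- Finite disjunction `⋁`. -/
def FormJ.bigOr {n : ℕ} : List (FormJ n) → FormJ n
  | [] => .and (.atom 0) (.neg (.atom 0))
  | [φ] => φ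
  | φ :: ψ :: rest => φ.or (FormJ.bigOr (ψ :: rest))

/-- Simultaneous update of the valuation of the (distinct) letters `ps i` to `X i`. -/
def Model.updateMany {W : Type} (M : Model W) {n : ℕ} (ps : Fin n → ℕ)
    (X : Fin n → Set W) : Model W :=
  ⟨M.rel, fun q => {w | (∃ i, ps i = q ∧ w ∈ X i) ∨ ((∀ i, ps i ≠ q) ∧ w ∈ M.val q)}⟩

/-- A concrete numerical encoding of `L∃U` formulas. -/
def Form.toNat : Form → ℕ
  | .atom p => Nat.pair 0 p
  | .neg φ => Nat.pair 1 φ.toNat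
  | .and φ ψ => Nat.pair 2 (Nat.pair φ.toNat ψ.toNat)
  | .box φ => Nat.pair 3 φ.toNat
  | .ex p φ => Nat.pair 4 (Nat.pair p φ.toNat)
  | .uni φ => Nat.pair 5 φ.toNat

/-- The language `L∃Uα`: `L∃U` with action modalities `⟨α⟩` for events `α` of an event model. -/
inductive FormA (n : ℕ) : Type where
  | atom : ℕ → FormA n
  | neg : FormA n → FormA n
  | and : FormA n → FormA n → FormA n
  | box : FormA n → FormA n
  | ex : ℕ → FormA n → FormA n
  | uni : FormA n → FormA n
  | act : Fin n → FormA n → FormA n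

/-- Satisfaction for `L∃Uα`, relative to a fixed event model `A`. -/
def SatA {n : ℕ} (A : EventModel n) : (W : Type) → Model W → W → FormA n → Prop
  | _, M, w, .atom p => w ∈ M.val p
  | W, M, w, .neg φ => ¬ SatA A W M w φ
  | W, M, w, .and φ ψ => SatA A W M w φ ∧ SatA A W M w ψ
  | W, M, w, .box φ => ∀ v, M.rel w v → SatA A W M v φ
  | W, M, w, .ex p φ => ∃ X : Set W, SatA A W (M.update p X) w φ
  | W, M, w, .uni φ => ∀ v, SatA A W M v φ
  | _, M, w, .act β φ => ∃ h : (w, β) ∈ prodDomain M A,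
      SatA A (prodDomain M A) (prodModel M A) ⟨(w, β), h⟩ φ

/-- The set of points reachable from `ω` in at most `k` steps along `R`. -/
def reachWithin {W : Type} (M : Model W) (ω : W) : ℕ → Set W
  | 0 => {ω}
  | k + 1 => reachWithin M ω k ∪ {v | ∃ u ∈ reachWithin M ω k, M.rel u v}

theorem mem_reachWithin_self {W : Type} (M : Model W) (ω : W) (k : ℕ) :
    ω ∈ reachWithin M ω k := by
  induction k with
  | zero => exact rfl
  | succ k ih => exact Or.inl ih

/-- `M^k_ω`: the submodel of `M` generated by going at most `k` steps along `R` from `ω`. -/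
def Model.genSub {W : Type} (M : Model W) (ω : W) (k : ℕ) : Model (reachWithin M ω k) :=
  M.restrict (reachWithin M ω k)

/-- `φ ∈ L∃U` has degree `k`. -/
def HasDegreeForm (φ : Form) (k : ℕ) : Prop :=
  ∀ (W : Type) (M : Model W) (ω : W),
    Sat M ω φ ↔ Sat (M.genSub ω k) ⟨ω, mem_reachWithin_self M ω k⟩ φ

/-- `φ ∈ L∃Uα` has degree `k`. -/
def HasDegreeA {n : ℕ} (A : EventModel n) (φ : FormA n) (k : ℕ) : Prop :=
  ∀ (W : Type) (M : Model W) (ω : W),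
    SatA A W M ω φ ↔
      SatA A (reachWithin M ω k) (M.genSub ω k) ⟨ω, mem_reachWithin_self M ω k⟩ φ

/-- `deg(φ)` for `φ ∈ L∃U` (the least degree; `sInf ∅ = 0` by convention). -/
noncomputable def degForm (φ : Form) : ℕ := sInf {k | HasDegreeForm φ k}

/-- `deg(φ)` for `φ ∈ L∃Uα`. -/
noncomputable def degA {n : ℕ} (A : EventModel n) (φ : FormA n) : ℕ :=
  sInf {k | HasDegreeA A φ k}

/-- `Z` is a bisimulation between `M` and `M'`. -/
def IsBisim {W W' : Type} (M : Model W) (M' : Model W') (Z : W → W' → Prop) : Prop :=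
  ∀ s t, Z s t →
    (∀ p, s ∈ M.val p ↔ t ∈ M'.val p) ∧
    (∀ s₁, M.rel s s₁ → ∃ t₁, M'.rel t t₁ ∧ Z s₁ t₁) ∧
    (∀ t₁, M'.rel t t₁ → ∃ s₁, M.rel s s₁ ∧ Z s₁ t₁)

/-- `φ ∈ L∃U` is bisimulation-invariant. -/
def BisimInvariant (φ : Form) : Prop :=
  ∀ (W W' : Type) (M : Model W) (M' : Model W') (Z : W → W' → Prop),
    IsBisim M M' Z → ∀ w w', Z w w' → (Sat M w φ ↔ Sat M' w' φ)

/-- The modal fixpoint language `L_μ` (with greatest-fixpoint binders `ν`). -/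
inductive Formμ : Type where
  | atom : ℕ → Formμ
  | neg : Formμ → Formμ
  | and : Formμ → Formμ → Formμ
  | box : Formμ → Formμ
  | nu : ℕ → Formμ → Formμ

mutual
/-- All occurrences of `p` are under an even number of negations. -/
def PosIn (p : ℕ) : Formμ → Prop
  | .atom _ => True
  | .neg φ => NegIn p φ
  | .and φ ψ => PosIn p φ ∧ PosIn p ψ
  | .box φ => PosIn p φ
  | .nu q φ => q = p ∨ PosIn p φ

/-- All occurrences of `p` are under an odd number of negations. -/
def NegIn (p : ℕ) : Formμ → Prop
  | .atom q => q ≠ p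
  | .neg φ => PosIn p φ
  | .and φ ψ => NegIn p φ ∧ NegIn p ψ
  | .box φ => NegIn p φ
  | .nu q φ => q = p ∨ NegIn p φ
end

/-- Well-formedness for `L_μ`: in each `νp.φ`, `φ` is positive in `p`. -/
def WFμ : Formμ → Prop
  | .atom _ => True
  | .neg φ => WFμ φ
  | .and φ ψ => WFμ φ ∧ WFμ ψ
  | .box φ => WFμ φ
  | .nu q φ => PosIn q φ ∧ WFμ φ

/-- Satisfaction for `L_μ`: `⟦νp.φ⟧ = ⋃ {X | ∀ ω ∈ X, M[p ↦ X], ω ⊨ φ}`. -/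
def Satμ {W : Type} : Model W → W → Formμ → Prop
  | M, w, .atom p => w ∈ M.val p
  | M, w, .neg φ => ¬ Satμ M w φ
  | M, w, .and φ ψ => Satμ M w φ ∧ Satμ M w ψ
  | M, w, .box φ => ∀ v, M.rel w v → Satμ M v φ
  | M, w, .nu q φ => w ∈ ⋃₀ {X : Set W | ∀ v ∈ X, Satμ (M.update q X) v φ}

/-- An event model with preconditions in `L_μ`. -/
structure EventModelμ (n : ℕ) where
  E : Fin n → Fin n → Prop
  pre : Fin n → Formμ

/-- The domain of the product update `M ⊗ A` for `L_μ` event models. -/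
def prodDomainμ {W : Type} (M : Model W) {n : ℕ} (A : EventModelμ n) : Set (W × Fin n) :=
  {x | Satμ M x.1 (A.pre x.2)}

/-- The product update `M ⊗ A` for `L_μ` event models. -/
def prodModelμ {W : Type} (M : Model W) {n : ℕ} (A : EventModelμ n) :
    Model (prodDomainμ M A) :=
  ⟨fun x y => M.rel x.1.1 y.1.1 ∧ A.E x.1.2 y.1.2, fun p => {x | x.1.1 ∈ M.val p}⟩

/-- `Pol true p` is positivity in `p`, `Pol false p` is negativity in `p`. -/
def Pol (b : Bool) (p : ℕ) (φ : Formμ) : Prop := if b then PosIn p φ else NegIn p φ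

theorem Pol.atom_iff {b : Bool} {p q : ℕ} : Pol b p (.atom q) ↔ b = true ∨ q ≠ p := by
  cases b <;> simp [Pol, PosIn, NegIn]

theorem Pol.neg_iff {b : Bool} {p : ℕ} {φ : Formμ} : Pol b p (.neg φ) ↔ Pol (!b) p φ := by
  cases b <;> simp [Pol, PosIn, NegIn]

theorem Pol.and_iff {b : Bool} {p : ℕ} {φ ψ : Formμ} :
    Pol b p (.and φ ψ) ↔ Pol b p φ ∧ Pol b p ψ := by
  cases b <;> simp [Pol, PosIn, NegIn]

theorem Pol.box_iff {b : Bool} {p : ℕ} {φ : Formμ} : Pol b p (.box φ) ↔ Pol b p φ := by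
  cases b <;> simp [Pol, PosIn, NegIn]

theorem Pol.nu_iff {b : Bool} {p q : ℕ} {φ : Formμ} :
    Pol b p (.nu q φ) ↔ q = p ∨ Pol b p φ := by
  cases b <;> simp [Pol, PosIn, NegIn]

/-- All sufficiently large letters do not occur free in `φ`. -/
theorem exists_fresh_bound (φ : Formμ) : ∃ N, ∀ p, N ≤ p → ∀ b, Pol b p φ := by
  induction φ with
  | atom q =>
    refine ⟨q + 1, fun p hp b => Pol.atom_iff.2 (Or.inr ?_)⟩
    omega
  | neg φ ih =>
    obtain ⟨N, hN⟩ := ih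
    exact ⟨N, fun p hp b => Pol.neg_iff.2 (hN p hp _)⟩
  | and φ ψ ih₁ ih₂ =>
    obtain ⟨N₁, h₁⟩ := ih₁
    obtain ⟨N₂, h₂⟩ := ih₂
    exact ⟨max N₁ N₂, fun p hp b => Pol.and_iff.2
      ⟨h₁ p (le_of_max_le_left hp) b, h₂ p (le_of_max_le_right hp) b⟩⟩
  | box φ ih =>
    obtain ⟨N, hN⟩ := ih
    exact ⟨N, fun p hp b => Pol.box_iff.2 (hN p hp _)⟩
  | nu q φ ih =>
    obtain ⟨N, hN⟩ := ih
    exact ⟨N, fun p hp b => Pol.nu_iff.2 (Or.inr (hN p hp _))⟩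

theorem Satμ.nu_iff {W : Type} {M : Model W} {w : W} {q : ℕ} {φ : Formμ} :
    Satμ M w (.nu q φ) ↔ ∃ X : Set W, (∀ v ∈ X, Satμ (M.update q X) v φ) ∧ w ∈ X := by
  simp only [Satμ, Set.mem_sUnion, Set.mem_ofPred_eq]

/-- Enlarging the letters without negative occurrences and shrinking those without positive
occurrences preserves satisfaction. -/
theorem Satμ.mono {W : Type} {φ : Formμ} {M M' : Model W} (hrel : M.rel = M'.rel)
    (hle : ∀ p, Pol false p φ ∨ M.val p ⊆ M'.val p)
    (hge : ∀ p, Pol true p φ ∨ M'.val p ⊆ M.val p) {w : W} (h : Satμ M w φ) :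
    Satμ M' w φ := by
  induction φ generalizing M M' w with
  | atom q => exact (hle q).resolve_left (by simp [Pol.atom_iff]) h
  | neg φ ih =>
    simp only [Pol.neg_iff] at hle hge
    exact fun h' => h (ih hrel.symm hge hle h')
  | and φ ψ ih₁ ih₂ =>
    simp only [Pol.and_iff] at hle hge
    exact ⟨ih₁ hrel (fun p => (hle p).imp_left And.left) (fun p => (hge p).imp_left And.left) h.1,
      ih₂ hrel (fun p => (hle p).imp_left And.right) (fun p => (hge p).imp_left And.right) h.2⟩
  | box φ ih =>
    simp only [Pol.box_iff] at hle hge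
    exact fun v hv => ih hrel hle hge (h v (hrel ▸ hv))
  | nu q φ ih =>
    simp only [Pol.nu_iff] at hle hge
    obtain ⟨X, hX, hw⟩ := Satμ.nu_iff.1 h
    refine Satμ.nu_iff.2 ⟨X, fun v hv => ih (M := M.update q X) (M' := M'.update q X) hrel ?_ ?_ (hX v hv), hw⟩
    · intro p
      by_cases hp : p = q
      · exact Or.inr (by simp [Model.update, hp])
      · simpa [Model.update, hp, Ne.symm hp] using hle p
    · intro p
      by_cases hp : p = q
      · exact Or.inr (by simp [Model.update, hp])
      · simpa [Model.update, hp, Ne.symm hp] using hge p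

/-- Satisfaction depends only on the letters occurring free. -/
theorem Satμ.congr {W : Type} {φ : Formμ} {M M' : Model W} (hrel : M.rel = M'.rel)
    (hval : ∀ p, (∀ b, Pol b p φ) ∨ M.val p = M'.val p) {w : W} :
    Satμ M w φ ↔ Satμ M' w φ :=
  ⟨Satμ.mono hrel (fun p => (hval p).imp (· _) Eq.subset)
      (fun p => (hval p).imp (· _) (Eq.subset ∘ Eq.symm)),
    Satμ.mono hrel.symm (fun p => (hval p).imp (· _) (Eq.subset ∘ Eq.symm))
      (fun p => (hval p).imp (· _) Eq.subset)⟩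

/-- Reinterpret every letter `p` by the extension of `σ p`. -/
def Model.interp {W : Type} (M : Model W) (σ : ℕ → Formμ) : Model W :=
  ⟨M.rel, fun p => {v | Satμ M v (σ p)}⟩

/-- Capture-avoiding simultaneous substitution, with control of polarities. -/
theorem exists_subst {φ : Formμ} (hφ : WFμ φ) {σ : ℕ → Formμ} (hσ : ∀ p, WFμ (σ p)) :
    ∃ φ' : Formμ, WFμ φ' ∧
      (∀ b r, (∀ p c, Pol c p φ ∨ Pol (xor b c) r (σ p)) → Pol b r φ') ∧
      ∀ (W : Type) (M : Model W) (w : W), Satμ M w φ' ↔ Satμ (M.interp σ) w φ := by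
  induction φ generalizing σ with
  | atom q =>
    refine ⟨σ q, hσ q, fun b r h => ?_, fun W M w => Iff.rfl⟩
    simpa [Pol.atom_iff] using h q false
  | neg φ ih =>
    obtain ⟨φ', hwf, hpol, hsat⟩ := ih hφ hσ
    refine ⟨.neg φ', hwf, fun b r h => Pol.neg_iff.2 (hpol _ _ fun p c => ?_),
      fun W M w => not_congr (hsat W M w)⟩
    simpa [Pol.neg_iff] using h p (!c)
  | and φ ψ ih₁ ih₂ =>
    obtain ⟨φ', hwf₁, hpol₁, hsat₁⟩ := ih₁ hφ.1 hσ
    obtain ⟨ψ', hwf₂, hpol₂, hsat₂⟩ := ih₂ hφ.2 hσ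
    refine ⟨.and φ' ψ', ⟨hwf₁, hwf₂⟩, fun b r h => Pol.and_iff.2 ⟨hpol₁ _ _ fun p c => ?_,
      hpol₂ _ _ fun p c => ?_⟩, fun W M w => and_congr (hsat₁ W M w) (hsat₂ W M w)⟩
    · exact (h p c).imp_left fun h => (Pol.and_iff.1 h).1
    · exact (h p c).imp_left fun h => (Pol.and_iff.1 h).2
  | box φ ih =>
    obtain ⟨φ', hwf, hpol, hsat⟩ := ih hφ hσ
    refine ⟨.box φ', hwf, fun b r h => Pol.box_iff.2 (hpol _ _ fun p c => ?_),
      fun W M w => forall₂_congr fun v _ => hsat W M v⟩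
    exact (h p c).imp_left Pol.box_iff.1
  | nu q φ ih =>
    obtain ⟨N, hN⟩ := exists_fresh_bound φ
    choose f hf using fun p => exists_fresh_bound (σ p)
    obtain ⟨y, hy⟩ : ∃ y, ∀ p, (∀ c, Pol c p φ) ∨ ∀ b, Pol b y (σ p) := by
      refine ⟨(Finset.range N).sup f, fun p => ?_⟩
      rcases le_or_gt N p with hp | hp
      · exact Or.inl (hN p hp)
      · exact Or.inr (hf p _ (Finset.le_sup (Finset.mem_range.2 hp)))
    obtain ⟨φ', hwf, hpol, hsat⟩ := ih hφ.2 (σ := Function.update σ q (.atom y)) (by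
      intro p
      by_cases hp : p = q
      · subst hp; simp [WFμ]
      · simpa [hp] using hσ p)
    refine ⟨.nu y φ', ⟨hpol true y fun p c => ?_, hwf⟩, fun b r h => Pol.nu_iff.2 ?_,
      fun W M w => ?_⟩
    · by_cases hp : p = q
      · subst hp
        cases c
        · exact Or.inr (by simp [Pol.atom_iff])
        · exact Or.inl hφ.1
      · simpa [hp] using (hy p).imp (· c) (· (!c))
    · by_cases hyr : y = r
      · exact Or.inl hyr
      · refine Or.inr (hpol b r fun p c => ?_)
        by_cases hp : p = q
        · exact Or.inr (by simp [hp, Pol.atom_iff, hyr])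
        · have := h p c
          simpa [hp, Ne.symm hp, Pol.nu_iff] using this
    · rw [Satμ.nu_iff, Satμ.nu_iff]
      refine exists_congr fun X => and_congr_left' (forall₂_congr fun v _ => ?_)
      rw [hsat]
      refine Satμ.congr (by rfl) fun p => ?_
      by_cases hp : p = q
      · exact Or.inr (by ext v; simp [hp, Model.interp, Model.update, Satμ])
      · refine (hy p).imp_right fun hyp => ?_
        ext v
        simp only [Model.interp, Model.update, Function.update_of_ne hp, hp, if_false,
          Set.mem_ofPred_eq]
        refine Satμ.congr (by rfl) fun r => ?_
        by_cases hr : r = y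
        · exact Or.inl (hr ▸ hyp)
        · exact Or.inr (by simp [hr])

/-- Finite conjunctions. -/
theorem exists_conj {ι : Type} (s : Finset ι) (φ : ι → Formμ) (hφ : ∀ i, WFμ (φ i)) :
    ∃ χ : Formμ, WFμ χ ∧ (∀ b r, (∀ i, Pol b r (φ i)) → Pol b r χ) ∧
      ∀ (W : Type) (M : Model W) (w : W), Satμ M w χ ↔ ∀ i ∈ s, Satμ M w (φ i) := by
  classical
  induction s using Finset.induction_on with
  | empty =>
    refine ⟨.nu 0 (.atom 0), ⟨trivial, trivial⟩, fun b r _ => ?_, fun W M w => ?_⟩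
    · rw [Pol.nu_iff, Pol.atom_iff]
      tauto
    · simpa [Satμ.nu_iff, Satμ, Model.update] using ⟨Set.univ, trivial⟩
  | insert a s _ ih =>
    obtain ⟨χ, hwf, hpol, hsat⟩ := ih
    refine ⟨.and (φ a) χ, ⟨hφ a, hwf⟩, fun b r h => Pol.and_iff.2 ⟨h a, hpol b r h⟩,
      fun W M w => ?_⟩
    simp [Satμ, hsat]

/-- Set the letters `y j`, for `j ∈ s`, to `Y j`. -/
def Model.updateOn {W ι : Type} (M : Model W) (s : Finset ι) (y : ι → ℕ)
    (Y : ι → Set W) : Model W :=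
  ⟨M.rel, fun q => {w | (∃ j ∈ s, y j = q ∧ w ∈ Y j) ∨ (∀ j ∈ s, y j ≠ q) ∧ w ∈ M.val q}⟩

theorem Model.updateOn_val_of_mem {W ι : Type} {M : Model W} {s : Finset ι} {y : ι → ℕ}
    (hy : Function.Injective y) {Y : ι → Set W} {j : ι} (hj : j ∈ s) :
    (M.updateOn s y Y).val (y j) = Y j := by
  ext w
  constructor
  · rintro (⟨k, _, hk, hw⟩ | ⟨h, _⟩)
    · exact hy hk ▸ hw
    · exact absurd rfl (h j hj)
  · exact fun hw => Or.inl ⟨j, hj, rfl, hw⟩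

theorem Model.updateOn_val_of_ne {W ι : Type} {M : Model W} {s : Finset ι} {y : ι → ℕ}
    {Y : ι → Set W} {q : ℕ} (hq : ∀ j ∈ s, y j ≠ q) :
    (M.updateOn s y Y).val q = M.val q := by
  ext w
  constructor
  · rintro (⟨k, hk, hkq, _⟩ | ⟨_, h⟩)
    · exact absurd hkq (hq k hk)
    · exact h
  · exact fun hw => Or.inr ⟨hq, hw⟩

/-- Bekić's principle: components of simultaneous greatest fixpoints are definable. -/
theorem exists_simultaneous_nu {ι : Type} {y : ι → ℕ} (hy : Function.Injective y)
    {φ : ι → Formμ} (hφ : ∀ i, WFμ (φ i)) (hpos : ∀ i j, Pol true (y i) (φ j))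
    (s : Finset ι) {i : ι} (hi : i ∈ s) :
    ∃ θ : Formμ, WFμ θ ∧
      (∀ b r, ((∃ j ∈ s, y j = r) ∨ ∀ j, Pol b r (φ j)) → Pol b r θ) ∧
      ∀ (W : Type) (M : Model W) (w : W), Satμ M w θ ↔
        ∃ Y : ι → Set W, (∀ j ∈ s, ∀ v ∈ Y j, Satμ (M.updateOn s y Y) v (φ j)) ∧ w ∈ Y i := by
  classical
  induction s using Finset.strongInduction generalizing i with
  | H s ih =>
  have : Nonempty Formμ := ⟨.atom 0⟩
  choose! θ hwf hpol hsat using fun j hj => ih _ (Finset.erase_ssubset hi) (i := j) hj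
  let σ : ℕ → Formμ := fun p =>
    if h : ∃ j ∈ s.erase i, y j = p then θ h.choose else .atom p
  have σ_mem : ∀ j ∈ s.erase i, σ (y j) = θ j := fun j hj => by
    have h : ∃ k ∈ s.erase i, y k = y j := ⟨j, hj, rfl⟩
    simp only [σ, dif_pos h, hy h.choose_spec.2]
  have σ_ne : ∀ p, (∀ j ∈ s.erase i, y j ≠ p) → σ p = .atom p := fun p hp =>
    dif_neg (by simpa using hp)
  have σ_cases : ∀ p, (∃ j ∈ s.erase i, y j = p) ∨ ∀ j ∈ s.erase i, y j ≠ p := fun p => by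
    by_cases h : ∃ j ∈ s.erase i, y j = p
    · exact Or.inl h
    · exact Or.inr (by simpa using h)
  have hσ : ∀ p, WFμ (σ p) := fun p => by
    obtain ⟨j, hj, rfl⟩ | hp := σ_cases p
    · exact σ_mem j hj ▸ hwf j hj
    · rw [σ_ne p hp]; trivial
  obtain ⟨φ', hwf', hpol', hsat'⟩ := exists_subst (hφ i) hσ
  have hpol'' : ∀ b r, ((∃ j ∈ s.erase i, y j = r) ∨ ∀ j, Pol b r (φ j)) → Pol b r φ' := by
    intro b r h
    refine hpol' b r fun p c => ?_
    obtain ⟨j, hj, rfl⟩ | hp := σ_cases p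
    · rw [σ_mem j hj]
      cases c
      · exact Or.inr (by simpa using hpol j hj b r h)
      · exact Or.inl (hpos j i)
    · rw [σ_ne p hp, Pol.atom_iff]
      by_cases hpr : p = r
      · subst hpr
        rcases h with ⟨j, hj, hjp⟩ | h
        · exact absurd hjp (hp j hj)
        · by_cases hbc : b = c
          · exact Or.inl (hbc ▸ h i)
          · exact Or.inr (Or.inl (bne_iff_ne.2 hbc))
      · exact Or.inr (Or.inr hpr)
  refine ⟨.nu (y i) φ', ⟨hpol'' true (y i) (Or.inr (hpos i)), hwf'⟩, fun b r h => ?_,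
    fun W M w => ?_⟩
  · rw [Pol.nu_iff]
    by_cases hr : y i = r
    · exact Or.inl hr
    · refine Or.inr (hpol'' b r (h.imp_left ?_))
      rintro ⟨j, hj, rfl⟩
      exact ⟨j, Finset.mem_erase.2 ⟨fun h => hr (h ▸ rfl), hj⟩, rfl⟩
  have val_erase : ∀ (X : Set W) (Y : ι → Set W), ∀ p, (∀ j ∈ s.erase i, y j ≠ p) →
      Y i = X → (M.updateOn s y Y).val p = (M.update (y i) X).val p := by
    intro X Y p hp hYi
    by_cases hpi : p = y i
    · subst hpi
      rw [Model.updateOn_val_of_mem hy hi, hYi]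
      simp [Model.update]
    · rw [Model.updateOn_val_of_ne fun j hj hjp =>
        hp j (Finset.mem_erase.2 ⟨fun h => hpi (by rw [← hjp, h]), hj⟩) hjp]
      simp [Model.update, hpi]
  rw [Satμ.nu_iff]
  constructor
  · rintro ⟨X, hX, hw⟩
    let Y : ι → Set W := fun j => if j = i then X else {v | Satμ (M.update (y i) X) v (θ j)}
    have hYi : Y i = X := if_pos rfl
    have hYj : ∀ j ∈ s.erase i, Y j = {v | Satμ (M.update (y i) X) v (θ j)} :=
      fun j hj => if_neg (Finset.ne_of_mem_erase hj)
    refine ⟨Y, fun j hj v hv => ?_, hYi ▸ hw⟩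
    by_cases hji : j = i
    · subst hji
      refine (Satμ.congr (by rfl) fun p => Or.inr ?_).1 ((hsat' _ _ _).1 (hX v (hYi ▸ hv)))
      obtain ⟨k, hk, rfl⟩ | hp := σ_cases p
      · rw [Model.updateOn_val_of_mem hy (Finset.mem_of_mem_erase hk), hYj k hk]
        simp only [Model.interp, σ_mem k hk]
      · rw [val_erase X Y p hp hYi]
        simp only [Model.interp, σ_ne p hp]
        rfl
    · have hj' := Finset.mem_erase.2 ⟨hji, hj⟩
      have hv' := hv
      rw [hYj j hj', Set.mem_ofPred_eq, hsat j hj'] at hv'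
      obtain ⟨Y', hY', hvY'⟩ := hv'
      refine Satμ.mono (by rfl) (fun p => Or.inr ?_) (fun p => ?_) (hY' j hj' v hvY')
      · obtain ⟨k, hk, rfl⟩ | hp := σ_cases p
        · rw [Model.updateOn_val_of_mem hy (Finset.mem_of_mem_erase hk),
            Model.updateOn_val_of_mem hy hk, hYj k hk]
          exact fun u hu => (hsat k hk _ _ _).2 ⟨Y', hY', hu⟩
        · rw [val_erase X Y p hp hYi, Model.updateOn_val_of_ne hp]
      · obtain ⟨k, hk, rfl⟩ | hp := σ_cases p
        · exact Or.inl (hpos k j)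
        · rw [val_erase X Y p hp hYi, Model.updateOn_val_of_ne hp]
          exact Or.inr subset_rfl
  · rintro ⟨Y, hY, hw⟩
    refine ⟨Y i, fun v hv => (hsat' _ _ _).2 ?_, hw⟩
    refine Satμ.mono (by rfl) (fun p => Or.inr ?_) (fun p => ?_) (hY i hi v hv)
    · obtain ⟨k, hk, rfl⟩ | hp := σ_cases p
      · rw [Model.updateOn_val_of_mem hy (Finset.mem_of_mem_erase hk)]
        simp only [Model.interp, σ_mem k hk]
        refine fun u hu => (hsat k hk _ _ _).2 ⟨Y, fun j hj v hv => ?_, hu⟩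
        refine (Satμ.congr (by rfl) fun p => Or.inr ?_).1 (hY j (Finset.mem_of_mem_erase hj) v hv)
        obtain ⟨l, hl, rfl⟩ | hp := σ_cases p
        · rw [Model.updateOn_val_of_mem hy (Finset.mem_of_mem_erase hl),
            Model.updateOn_val_of_mem hy hl]
        · rw [val_erase (Y i) Y p hp rfl, Model.updateOn_val_of_ne hp]
      · rw [val_erase (Y i) Y p hp rfl]
        simp only [Model.interp, σ_ne p hp]
        exact subset_rfl
    · obtain ⟨k, hk, rfl⟩ | hp := σ_cases p
      · exact Or.inl (hpos k i)
      · rw [val_erase (Y i) Y p hp rfl]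
        simp only [Model.interp, σ_ne p hp]
        exact Or.inr subset_rfl

/-- Translation along a product update in which the letter `p` at event `k` is represented by the
letter `c p k`, these letters not occurring in the preconditions. -/
theorem exists_translation {n : ℕ} (A : EventModelμ n) (hA : ∀ i, WFμ (A.pre i))
    {c : ℕ → Fin n → ℕ} (hc : Function.Injective (Function.uncurry c))
    (hfresh : ∀ p k i b, Pol b (c p k) (A.pre i)) {ψ : Formμ} (hψ : WFμ ψ) (i : Fin n) :
    ∃ χ : Formμ, WFμ χ ∧ (∀ b p k, Pol b p ψ → Pol b (c p k) χ) ∧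
      ∀ (W : Type) (M : Model W) (D : Set (W × Fin n)) (P : Model D),
        (∀ w j, (w, j) ∈ D ↔ Satμ M w (A.pre j)) →
        (∀ x y, P.rel x y ↔ M.rel x.1.1 y.1.1 ∧ A.E x.1.2 y.1.2) →
        (∀ p (x : D), x ∈ P.val p ↔ x.1.1 ∈ M.val (c p x.1.2)) →
        ∀ w (h : (w, i) ∈ D), Satμ M w χ ↔ Satμ P ⟨(w, i), h⟩ ψ := by
  classical
  have hc' : ∀ {p q k l}, c p k = c q l → p = q ∧ k = l := fun {p q k l} h =>
    Prod.ext_iff.1 (hc (a₁ := (p, k)) (a₂ := (q, l)) h)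
  induction ψ generalizing i with
  | atom p =>
    refine ⟨.atom (c p i), trivial, fun b q k h => ?_,
      fun W M D P _ _ hval w h => (hval p ⟨(w, i), h⟩).symm⟩
    rw [Pol.atom_iff] at h ⊢
    exact h.imp_right fun h h' => h (hc' h').1
  | neg φ ih =>
    obtain ⟨χ, hwf, hpol, hsat⟩ := ih hψ i
    exact ⟨.neg χ, hwf, fun b p k h => Pol.neg_iff.2 (hpol _ _ _ (Pol.neg_iff.1 h)),
      fun W M D P hD hrel hval w h => not_congr (hsat W M D P hD hrel hval w h)⟩
  | and φ₁ φ₂ ih₁ ih₂ =>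
    obtain ⟨χ₁, hwf₁, hpol₁, hsat₁⟩ := ih₁ hψ.1 i
    obtain ⟨χ₂, hwf₂, hpol₂, hsat₂⟩ := ih₂ hψ.2 i
    exact ⟨.and χ₁ χ₂, ⟨hwf₁, hwf₂⟩, fun b p k h => Pol.and_iff.2
        ⟨hpol₁ _ _ _ (Pol.and_iff.1 h).1, hpol₂ _ _ _ (Pol.and_iff.1 h).2⟩,
      fun W M D P hD hrel hval w h => and_congr (hsat₁ W M D P hD hrel hval w h)
        (hsat₂ W M D P hD hrel hval w h)⟩
  | box φ ih =>
    choose χ hwf hpol hsat using ih hψ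
    obtain ⟨θ, hwf', hpol', hsat'⟩ := exists_conj (Finset.univ.filter (A.E i))
      (fun j => .box (.neg (.and (A.pre j) (.neg (χ j))))) (fun j => ⟨hA j, hwf j⟩)
    refine ⟨θ, hwf', fun b p k h => hpol' _ _ fun j => ?_,
      fun W M D P hD hrel hval w h => ?_⟩
    · simp only [Pol.box_iff, Pol.neg_iff, Pol.and_iff, Bool.not_not] at h ⊢
      exact ⟨hfresh _ _ _ _, hpol _ _ _ _ h⟩
    · simp only [hsat', Finset.mem_filter, Finset.mem_univ, true_and, Satμ, not_and, not_not]
      constructor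
      · rintro H ⟨⟨v, j⟩, hv⟩ hR
        obtain ⟨hR, hE⟩ := (hrel _ _).1 hR
        exact (hsat j W M D P hD hrel hval v hv).1 (H j hE v hR ((hD v j).1 hv))
      · intro H j hE v hR hv
        exact (hsat j W M D P hD hrel hval v ((hD v j).2 hv)).2
          (H ⟨(v, j), (hD v j).2 hv⟩ ((hrel _ _).2 ⟨hR, hE⟩))
  | nu q φ ih =>
    choose χ hwf hpol hsat using ih hψ.2
    obtain ⟨θ, hwf', hpol', hsat'⟩ := exists_simultaneous_nu (y := c q)
      (fun k l h => (hc' h).2) hwf (fun k j => hpol j true q k hψ.1) Finset.univ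
      (Finset.mem_univ i)
    refine ⟨θ, hwf', fun b p k h => hpol' _ _ ?_, fun W M D P hD hrel hval w h => ?_⟩
    · exact (Pol.nu_iff.1 h).imp (fun h => ⟨k, Finset.mem_univ k, by rw [h]⟩)
        (fun h j => hpol j b p k h)
    have key : ∀ (Y : Fin n → Set W) (X : Set D), (∀ x : D, x ∈ X ↔ x.1.1 ∈ Y x.1.2) →
        ∀ v j (hv : (v, j) ∈ D), Satμ (M.updateOn Finset.univ (c q) Y) v (χ j) ↔
          Satμ (P.update q X) ⟨(v, j), hv⟩ φ := by
      intro Y X hXY v j hv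
      refine hsat j W (M.updateOn Finset.univ (c q) Y) D (P.update q X) (fun u k => (hD u k).trans (Satμ.congr (by rfl) fun p => ?_)) hrel
        (fun p x => ?_) v hv
      · by_cases hp : ∃ l, c q l = p
        · obtain ⟨l, rfl⟩ := hp
          exact Or.inl (hfresh q l k)
        · exact Or.inr (Model.updateOn_val_of_ne fun l _ hl => hp ⟨l, hl⟩).symm
      · by_cases hp : p = q
        · subst hp
          rw [Model.updateOn_val_of_mem (fun k l h => (hc' h).2) (Finset.mem_univ _)]
          simpa [Model.update] using hXY x
        · rw [Model.updateOn_val_of_ne fun l _ hl => hp (hc' hl).1.symm]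
          simpa [Model.update, hp] using hval p x
    rw [hsat', Satμ.nu_iff]
    constructor
    · rintro ⟨Y, hY, hw⟩
      exact ⟨{x | x.1.1 ∈ Y x.1.2}, fun ⟨⟨v, j⟩, hv⟩ hx => (key Y _ (fun _ => Iff.rfl) v j hv).1
        (hY j (Finset.mem_univ j) v hx), hw⟩
    · rintro ⟨X, hX, hw⟩
      refine ⟨fun j => {v | ∃ hv : (v, j) ∈ D, ⟨(v, j), hv⟩ ∈ X}, ?_, h, hw⟩
      rintro j _ v ⟨hv, hvX⟩
      exact (key (fun j => {v | ∃ hv : (v, j) ∈ D, ⟨(v, j), hv⟩ ∈ X}) X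
        (fun x => ⟨fun hx => ⟨x.2, hx⟩, fun ⟨_, hx⟩ => hx⟩) v j hv).2 (hX _ hvX)

/-- The modal μ-calculus is closed for product update: for every event
model with preconditions in `L_μ`, every event `α` and every `ψ ∈ L_μ`, there is
`χ ∈ L_μ` with `χ ≡ ⟨α⟩ψ` valid: for every model `M` and point `ω`, `M, ω ⊨ χ` iff
`M, ω ⊨ Pre_α` and `M ⊗ A, (ω, α) ⊨ ψ`. -/
theorem stmt14 (n : ℕ) (hn : 0 < n) (A : EventModelμ n) (hA : ∀ i, WFμ (A.pre i))
    (α : Fin n) (ψ : Formμ) (hψ : WFμ ψ) :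
    ∃ χ : Formμ, WFμ χ ∧
      ∀ (W : Type) (M : Model W) (ω : W),
        Satμ M ω χ ↔
          ∃ h : (ω, α) ∈ prodDomainμ M A, Satμ (prodModelμ M A) ⟨(ω, α), h⟩ ψ := by
  choose N hN using fun i => exists_fresh_bound (A.pre i)
  let B := Finset.univ.sup N
  have hB : ∀ p, B ≤ p → ∀ i b, Pol b p (A.pre i) := fun p hp i =>
    hN i p ((Finset.le_sup (Finset.mem_univ i)).trans hp)
  let c : ℕ → Fin n → ℕ := fun p k => B + Nat.pair p k
  have hc : Function.Injective (Function.uncurry c) := by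
    rintro ⟨p, k⟩ ⟨q, l⟩ h
    obtain ⟨h₁, h₂⟩ := Nat.pair_eq_pair.1 (Nat.add_left_cancel h)
    exact Prod.ext h₁ (Fin.ext h₂)
  obtain ⟨χ, hχ, -, hsat⟩ := exists_translation A hA hc
    (fun p k i b => hB _ (Nat.le_add_right _ _) i b) hψ α
  let σ : ℕ → Formμ := fun r => .atom (if r < B then r else (Nat.unpair (r - B)).1)
  obtain ⟨χ', hχ', -, hsat'⟩ := exists_subst hχ (σ := σ) fun _ => trivial
  refine ⟨.and (A.pre α) χ', ⟨hA α, hχ'⟩, fun W M ω => ?_⟩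
  have hmain : ∀ h : (ω, α) ∈ prodDomainμ M A,
      Satμ M ω χ' ↔ Satμ (prodModelμ M A) ⟨(ω, α), h⟩ ψ := fun h => by
    rw [hsat']
    refine hsat W (M.interp σ) _ (prodModelμ M A) (fun w j => Satμ.congr (by rfl) fun p => ?_)
      (fun _ _ => Iff.rfl) (fun p x => ?_) ω h
    · rcases lt_or_ge p B with hp | hp
      · exact Or.inr (by ext v; simp [Model.interp, σ, hp, Satμ])
      · exact Or.inl (hB p hp j)
    · simp [Model.interp, σ, c, Satμ, prodModelμ]
  exact ⟨fun ⟨h₁, h₂⟩ => ⟨h₁, (hmain h₁).1 h₂⟩, fun ⟨h₁, h₂⟩ => ⟨h₁, (hmain h₁).2 h₂⟩⟩
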